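/- arXiv:1507.02638 — 5 statements merged into one kernel-verified Lean document; each statement's English description precedes it below -/
import Mathlib

section
/- Let G = (E, V, m) be a connected locally finite weighted graph with finite volume (Σ_{x∈V} m(x) < ∞), and let θ : V × V → ℝ be antisymmetric with θ(x,y) = 0 whenever E(x,y) = 0, such that for some cycle γ_0 the holonomy Hol_θ(γ_0) is nonzero in ℝ/2πℤ. Then there exists ν ≥ 0 such that the set {λ ∈ ℝ : there exists a nonzero f ∈ ℓ²(V,m) with f(x) = e^{iλθ(x,y)} f(y) for every pair x, y with E(x,y) > 0} equals νℤ; in particular the kernel of the magnetic Laplacian Δ_{G,λθ} is nontrivial if and only if λ ∈ νℤ. -/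
open scoped BigOperators ENNReal

noncomputable section

namespace MagneticCusp

attribute [local instance] Classical.propDecidable

variable {V V1 V2 : Type*}

/-- The axioms of a weighted graph `(E, V, m)`: `E` is symmetric, non-negative,
with no loops, `m` is a positive weight, and the graph is locally finite. -/
def GraphAxioms (E : V → V → ℝ) (m : V → ℝ) : Prop :=
  (∀ x y, E x y = E y x) ∧ (∀ x y, 0 ≤ E x y) ∧ (∀ x, E x x = 0) ∧ (∀ x, 0 < m x) ∧
    ∀ x, {y | 0 < E x y}.Finite

/-- Connectedness of the graph with edge weight `E`. -/
def Conn (E : V → V → ℝ) : Prop :=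
  ∀ x y, Relation.ReflTransGen (fun a b => 0 < E a b) x y

/-- A (real representative of a) magnetic potential: antisymmetric, vanishing off edges. -/
def MagneticPotential (E θ : V → V → ℝ) : Prop :=
  (∀ x y, θ y x = -θ x y) ∧ ∀ x y, E x y = 0 → θ x y = 0

/-- `γ` is a cycle of length `N` in the graph with edge weight `E`. -/
def IsCycle (E : V → V → ℝ) (γ : ℕ → V) (N : ℕ) : Prop :=
  γ N = γ 0 ∧ ∀ i < N, 0 < E (γ i) (γ (i + 1))

/-- The holonomy (flux) of the magnetic potential `θ` along `γ` (a real representative;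
it is to be considered modulo `2π`). -/
def hol (θ : V → V → ℝ) (γ : ℕ → V) (N : ℕ) : ℝ :=
  ∑ i ∈ Finset.range N, θ (γ i) (γ (i + 1))

/-- `Hol_θ = 0`: every cycle has vanishing holonomy in `ℝ/2πℤ`. -/
def HolTrivial (E θ : V → V → ℝ) : Prop :=
  ∀ (γ : ℕ → V) (N : ℕ), IsCycle E γ N → ∃ k : ℤ, hol θ γ N = 2 * Real.pi * k

/-- The magnetic Laplacian `Δ_{G,θ}` acting on functions. -/
def lap (E : V → V → ℝ) (m : V → ℝ) (θ : V → V → ℝ) (f : V → ℂ) (x : V) : ℂ :=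
  ((m x : ℝ) : ℂ)⁻¹ *
    ∑' y, ((E x y : ℝ) : ℂ) * (f x - Complex.exp (((θ x y : ℝ) : ℂ) * Complex.I) * f y)

/-- The magnetic quadratic form `Q_{G,θ}`. -/
def quadForm (E θ : V → V → ℝ) (f : V → ℂ) : ℝ :=
  (1 / 2) * ∑' x, ∑' y, E x y * ‖f x - Complex.exp (((θ x y : ℝ) : ℂ) * Complex.I) * f y‖ ^ 2

/-- The degree `deg_G(x) = m(x)⁻¹ Σ_y E(x,y)`. -/
def degree (E : V → V → ℝ) (m : V → ℝ) (x : V) : ℝ := (m x)⁻¹ * ∑' y, E x y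

/-- The squared norm of `f` in `ℓ²(V,m)`. -/
def nrmSq (m : V → ℝ) (f : V → ℂ) : ℝ := ∑' x, m x * ‖f x‖ ^ 2

/-- Membership in `ℓ²(V,m)`. -/
def MemL2 (m : V → ℝ) (f : V → ℂ) : Prop := Summable fun x => m x * ‖f x‖ ^ 2

/-- The quadratic form `⟨f, deg_G(·) f⟩` of the multiplication operator by the degree. -/
def degForm (E : V → V → ℝ) (m : V → ℝ) (f : V → ℂ) : ℝ :=
  ∑' x, m x * degree E m x * ‖f x‖ ^ 2

/-- Weight of the product of two weighted graphs. -/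
def prodM (m1 : V1 → ℝ) (m2 : V2 → ℝ) : V1 × V2 → ℝ := fun p => m1 p.1 * m2 p.2

/-- Edge weight of the product of `G1` by `G2` through `I ⊆ V2`. -/
def prodE (E1 : V1 → V1 → ℝ) (E2 : V2 → V2 → ℝ) (I : Set V2) :
    V1 × V2 → V1 × V2 → ℝ := fun p q =>
  (if p.2 = q.2 ∧ p.2 ∈ I then E1 p.1 q.1 else 0) + (if p.1 = q.1 then E2 p.2 q.2 else 0)

/-- Edge weight of the Cartesian product of `G1` by `G2`. -/
def cartE (E1 : V1 → V1 → ℝ) (m1 : V1 → ℝ) (E2 : V2 → V2 → ℝ) (m2 : V2 → ℝ) :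
    V1 × V2 → V1 × V2 → ℝ := fun p q =>
  (if p.2 = q.2 then E1 p.1 q.1 * m2 p.2 else 0) + (if p.1 = q.1 then m1 p.1 * E2 p.2 q.2 else 0)

/-- Magnetic potential of the product of `G1` by `G2`. -/
def prodTheta (θ1 : V1 → V1 → ℝ) (θ2 : V2 → V2 → ℝ) : V1 × V2 → V1 × V2 → ℝ := fun p q =>
  (if p.2 = q.2 then θ1 p.1 q.1 else 0) + (if p.1 = q.1 then θ2 p.2 q.2 else 0)

/-- Hypothesis (H1): `m1(x) → 0` as `x → ∞` (on an infinite vertex set). -/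
def H1cond (m1 : V1 → ℝ) : Prop :=
  Infinite V1 ∧ ∀ ε : ℝ, 0 < ε → {x : V1 | ε ≤ m1 x}.Finite

/-- Hypothesis (H3): the degree of `G1` is bounded. -/
def H3cond (E1 : V1 → V1 → ℝ) (m1 : V1 → ℝ) : Prop :=
  ∃ d : ℝ, ∀ x, degree E1 m1 x ≤ d

/-- The quadratic form of the operator `m1⁻¹(·) ⊗ Δ_{G2,θ2}` on `ℓ²(V1 × V2, m1 ⊗ m2)`:
`⟨f, (m1⁻¹(·) ⊗ Δ_{G2,θ2}) f⟩ = Σ_x Q_{G2,θ2}(f(x,·))`. -/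
def fiberForm (E2 θ2 : V2 → V2 → ℝ) (f : V1 × V2 → ℂ) : ℝ :=
  ∑' x : V1, quadForm E2 θ2 fun y => f (x, y)

/-- A simple cycle: closed walk of length `≥ 3` with pairwise distinct vertices. -/
def IsSimpleCycle (E : V → V → ℝ) (γ : ℕ → V) (N : ℕ) : Prop :=
  3 ≤ N ∧ γ N = γ 0 ∧ (∀ i < N, 0 < E (γ i) (γ (i + 1))) ∧
    ∀ i < N, ∀ j < N, γ i = γ j → i = j

/-- The weighted length of an edge, `L_G(x,y) = sqrt(min(m x, m y)/E x y)`. -/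
def edgeLength (E : V → V → ℝ) (m : V → ℝ) (x y : V) : ℝ :=
  Real.sqrt (min (m x) (m y) / E x y)

/-- The weighted length of a cycle. -/
def cycleLength (E : V → V → ℝ) (m : V → ℝ) (γ : ℕ → V) (N : ℕ) : ℝ :=
  ∑ i ∈ Finset.range N, edgeLength E m (γ i) (γ (i + 1))

/-- The (weighted) girth: infimum of the weighted lengths of simple cycles (`∞` if none). -/
def girth (E : V → V → ℝ) (m : V → ℝ) : ℝ≥0∞ :=
  ⨅ c : {c : (ℕ → V) × ℕ // IsSimpleCycle E c.1 c.2},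
    ENNReal.ofReal (cycleLength E m c.1.1 c.1.2)

/-- The radius of injectivity: half the girth. -/
def injRad (E : V → V → ℝ) (m : V → ℝ) : ℝ≥0∞ := girth E m / 2

/-- Min-max encoding: there is an `n`-dimensional subspace of finitely supported
functions (the form core) on which `Q ≤ lam ‖·‖²_{ℓ²(V,m)}`.  For the self-adjoint
operator associated to the form `Q` with form core `C_c(V)` this says
`N_lam(H) = dim ran 1_{(-∞,lam]}(H) ≥ n`. -/
def DimGE (Q : (V → ℂ) → ℝ) (m : V → ℝ) (lam : ℝ) (n : ℕ) : Prop :=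
  ∃ g : Fin n → V → ℂ, LinearIndependent ℂ g ∧
    (∀ i, (Function.support (g i)).Finite) ∧
    ∀ f ∈ Submodule.span ℂ (Set.range g), Q f ≤ lam * nrmSq m f

/-- Compact resolvent (equivalently: empty essential spectrum) of the non-negative
self-adjoint operator associated to the form `Q`, encoded via min-max:
`N_lam(H) < ∞` for every `lam`. -/
def CompactResolvent (Q : (V → ℂ) → ℝ) (m : V → ℝ) : Prop :=
  ∀ lam : ℝ, ∃ n : ℕ, ∀ k : ℕ, DimGE Q m lam k → k ≤ n

/-- The eigenvalue counting function `N_lam(H) = dim ran 1_{(-∞,lam]}(H)`,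
encoded via min-max over the form core. -/
def countEig (Q : (V → ℂ) → ℝ) (m : V → ℝ) (lam : ℝ) : ℕ :=
  sSup {k : ℕ | DimGE Q m lam k}

/-- The `n`-th eigenvalue (counted with multiplicity, `n` starting at `0`) of the
self-adjoint operator associated to `Q`, via the Courant min-max principle. -/
def eigVal (Q : (V → ℂ) → ℝ) (m : V → ℝ) (n : ℕ) : ℝ :=
  sInf {t : ℝ | DimGE Q m t (n + 1)}

/-- Equality of the form domains of the two non-negative forms `Q1`, `Q2`, both with
form core the finitely supported functions: by the closed graph theorem this is
equivalent to the equivalence of the form norms on the common core. -/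
def SameFormDomain (Q1 Q2 : (V → ℂ) → ℝ) (m : V → ℝ) : Prop :=
  ∃ c1 c2 : ℝ, 0 < c1 ∧ 0 < c2 ∧ ∀ f : V → ℂ, (Function.support f).Finite →
    c1 * (nrmSq m f + Q1 f) ≤ nrmSq m f + Q2 f ∧
      nrmSq m f + Q2 f ≤ c2 * (nrmSq m f + Q1 f)


/-- `f` is covariantly constant for the magnetic potential `lam • θ`. -/
def IsCovConst (E θ : V → V → ℝ) (lam : ℝ) (f : V → ℂ) : Prop :=
  ∀ x y, 0 < E x y → f x = Complex.exp (((lam * θ x y : ℝ) : ℂ) * Complex.I) * f y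

theorem IsCovConst.mul {E θ : V → V → ℝ} {a b : ℝ} {f g : V → ℂ}
    (hf : IsCovConst E θ a f) (hg : IsCovConst E θ b g) :
    IsCovConst E θ (a + b) (f * g) := by
  intro x y hxy
  have h : (((a + b) * θ x y : ℝ) : ℂ) * Complex.I =
      ((a * θ x y : ℝ) : ℂ) * Complex.I + ((b * θ x y : ℝ) : ℂ) * Complex.I := by
    push_cast
    ring
  rw [Pi.mul_apply, Pi.mul_apply, hf x y hxy, hg x y hxy, h, Complex.exp_add]
  ring

theorem IsCovConst.inv {E θ : V → V → ℝ} {a : ℝ} {f : V → ℂ} (hf : IsCovConst E θ a f) :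
    IsCovConst E θ (-a) f⁻¹ := by
  intro x y hxy
  have h : ((-a * θ x y : ℝ) : ℂ) * Complex.I = -(((a * θ x y : ℝ) : ℂ) * Complex.I) := by
    push_cast
    ring
  rw [Pi.inv_apply, Pi.inv_apply, hf x y hxy, h, Complex.exp_neg, mul_inv]

theorem IsCovConst.norm_eq {E θ : V → V → ℝ} {a : ℝ} {f : V → ℂ} (hconn : Conn E)
    (hf : IsCovConst E θ a f) (x y : V) : ‖f x‖ = ‖f y‖ := by
  induction hconn x y with
  | refl => rfl
  | tail _ hbc ih => rw [ih, hf _ _ hbc, norm_mul, Complex.norm_exp_ofReal_mul_I, one_mul]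

theorem IsCovConst.ne_zero_apply {E θ : V → V → ℝ} {a : ℝ} {f : V → ℂ} (hconn : Conn E)
    (hf : IsCovConst E θ a f) (hne : f ≠ 0) (x : V) : f x ≠ 0 := by
  obtain ⟨y, hy⟩ := Function.ne_iff.mp hne
  rw [← norm_ne_zero_iff, hf.norm_eq hconn x y]
  exact norm_ne_zero_iff.mpr hy

theorem IsCovConst.memL2 {E θ : V → V → ℝ} {m : V → ℝ} {a : ℝ} {f : V → ℂ} (hconn : Conn E)
    (hvol : Summable m) (hf : IsCovConst E θ a f) (x₀ : V) : MemL2 m f := by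
  simpa only [MemL2, hf.norm_eq hconn _ x₀] using hvol.mul_right (‖f x₀‖ ^ 2)

theorem IsCovConst.apply_zero {E θ : V → V → ℝ} {a : ℝ} {f : V → ℂ} (hf : IsCovConst E θ a f)
    {γ : ℕ → V} {N : ℕ} (hγ : ∀ i < N, 0 < E (γ i) (γ (i + 1))) :
    f (γ 0) = Complex.exp (((a * hol θ γ N : ℝ) : ℂ) * Complex.I) * f (γ N) := by
  induction N with
  | zero => simp [hol]
  | succ N ih =>
    have h : ((a * hol θ γ (N + 1) : ℝ) : ℂ) * Complex.I =
        ((a * hol θ γ N : ℝ) : ℂ) * Complex.I +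
          ((a * θ (γ N) (γ (N + 1)) : ℝ) : ℂ) * Complex.I := by
      rw [hol, Finset.sum_range_succ, ← hol]
      push_cast
      ring
    rw [ih fun i hi => hγ i (by lia), hf _ _ (hγ N (by lia)), h, Complex.exp_add, mul_assoc]

theorem IsCovConst.mul_hol_eq {E θ : V → V → ℝ} {a : ℝ} {f : V → ℂ} (hconn : Conn E)
    (hf : IsCovConst E θ a f) (hne : f ≠ 0) {γ : ℕ → V} {N : ℕ} (hγ : IsCycle E γ N) :
    ∃ k : ℤ, a * hol θ γ N = k * (2 * Real.pi) := by
  have h := hf.apply_zero hγ.2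
  rw [hγ.1, right_eq_mul₀ (hf.ne_zero_apply hconn hne _), Complex.exp_eq_one_iff] at h
  obtain ⟨k, hk⟩ := h
  refine ⟨k, ?_⟩
  rw [← mul_assoc] at hk
  exact_mod_cast mul_right_cancel₀ Complex.I_ne_zero hk

/-- The additive group of coupling constants for which the potential is gauge trivial. -/
def couplingSubgroup (E θ : V → V → ℝ) : AddSubgroup ℝ where
  carrier := {a | ∃ f : V → ℂ, (∀ x, f x ≠ 0) ∧ IsCovConst E θ a f}
  zero_mem' := ⟨1, fun _ => one_ne_zero, fun _ _ _ => by simp⟩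
  add_mem' := by
    rintro a b ⟨f, hf0, hf⟩ ⟨g, hg0, hg⟩
    exact ⟨f * g, fun x => mul_ne_zero (hf0 x) (hg0 x), hf.mul hg⟩
  neg_mem' := by
    rintro a ⟨f, hf0, hf⟩
    exact ⟨f⁻¹, fun x => inv_ne_zero (hf0 x), hf.inv⟩

theorem mem_couplingSubgroup_iff {E θ : V → V → ℝ} {m : V → ℝ} {a : ℝ} [Nonempty V]
    (hconn : Conn E) (hvol : Summable m) :
    a ∈ couplingSubgroup E θ ↔ ∃ f : V → ℂ, f ≠ 0 ∧ MemL2 m f ∧ IsCovConst E θ a f := by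
  obtain ⟨x₀⟩ := ‹Nonempty V›
  constructor
  · rintro ⟨f, hf0, hf⟩
    exact ⟨f, Function.ne_iff.mpr ⟨x₀, hf0 x₀⟩, hf.memL2 hconn hvol x₀, hf⟩
  · rintro ⟨f, hne, -, hf⟩
    exact ⟨f, hf.ne_zero_apply hconn hne, hf⟩

theorem couplingSubgroup_cyclic {E θ : V → V → ℝ} (hconn : Conn E) {γ : ℕ → V} {N : ℕ}
    (hγ : IsCycle E γ N) (hhol : hol θ γ N ≠ 0) :
    ∃ b, couplingSubgroup E θ = AddSubgroup.closure {b} := by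
  have hpos : 0 < |hol θ γ N| := abs_pos.mpr hhol
  refine AddSubgroup.cyclic_of_isolated_zero (a := 2 * Real.pi / |hol θ γ N|)
    (by positivity) (Set.disjoint_left.mpr ?_)
  rintro a ⟨f, hf0, hf⟩ ⟨ha0, ha⟩
  obtain ⟨k, hk⟩ := hf.mul_hol_eq hconn (Function.ne_iff.mpr ⟨γ 0, hf0 _⟩) hγ
  have habs : a * |hol θ γ N| = |(k : ℝ)| * (2 * Real.pi) := by
    rw [← abs_of_pos ha0, ← abs_mul, hk, abs_mul, abs_of_pos Real.two_pi_pos]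
  rw [lt_div_iff₀ hpos, habs] at ha
  have hk1 : |(k : ℝ)| < 1 := by nlinarith [Real.two_pi_pos]
  have hk0 : k = 0 := Int.abs_lt_one_iff.mp (by exact_mod_cast hk1)
  rw [hk0, Int.cast_zero, abs_zero, zero_mul] at habs
  exact (mul_pos ha0 hpos).ne' habs

/-- Coupling constant effect: if some cycle has nonzero holonomy for
`θ`, then the set of `λ` for which the kernel of `Δ_{G,λθ}` is nontrivial is `νℤ` for
some `ν ≥ 0`. -/
theorem coupling_constant_kernel
    (E : V → V → ℝ) (m : V → ℝ) (θ : V → V → ℝ)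
    (hG : GraphAxioms E m) (hconn : Conn E) (hθ : MagneticPotential E θ)
    (hvol : Summable m)
    (γ0 : ℕ → V) (N0 : ℕ) (hγ0 : IsCycle E γ0 N0)
    (hhol : ¬∃ k : ℤ, hol θ γ0 N0 = 2 * Real.pi * k) :
    ∃ ν : ℝ, 0 ≤ ν ∧
      {lam : ℝ | ∃ f : V → ℂ, f ≠ 0 ∧ MemL2 m f ∧
          ∀ x y, 0 < E x y →
            f x = Complex.exp (((lam * θ x y : ℝ) : ℂ) * Complex.I) * f y} =
        {lam : ℝ | ∃ k : ℤ, lam = (k : ℝ) * ν} := by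
  have : Nonempty V := ⟨γ0 0⟩
  have hhol0 : hol θ γ0 N0 ≠ 0 := fun h => hhol ⟨0, by simpa using h⟩
  obtain ⟨b, hb⟩ := couplingSubgroup_cyclic hconn hγ0 hhol0
  refine ⟨|b|, abs_nonneg b, ?_⟩
  ext lam
  rw [Set.mem_ofPred_eq, Set.mem_ofPred_eq]
  refine (mem_couplingSubgroup_iff hconn hvol).symm.trans ?_
  rw [hb, AddSubgroup.mem_closure_singleton]
  simp only [zsmul_eq_mul]
  rcases abs_choice b with h | h <;> rw [h]
  · exact exists_congr fun _ => eq_comm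
  · constructor <;> rintro ⟨k, rfl⟩ <;> exact ⟨-k, by simp⟩

end MagneticCusp
end
end

section
/- Let G = G1 ×_I G2 be the product of weighted graphs G1 = (E1, V1, m1) and G2 = (E2, V2, m2) through I ⊆ V2, with magnetic potential θ built from θ1 and θ2. Then for every (x,y) ∈ V1 × V2, deg_G(x,y) = deg_{G1}(x)·1_I(y)/m2(y) + deg_{G2}(y)/m1(x), and for every finitely supported f : V1 × V2 → ℂ, (Δ_{G,θ} f)(x,y) = (1_I(y)/m2(y))·(Δ_{G1,θ1} f(·,y))(x) + (1/m1(x))·(Δ_{G2,θ2} f(x,·))(y). -/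
open scoped BigOperators ENNReal

noncomputable section

namespace MagneticCusp

attribute [local instance] Classical.propDecidable

variable {V V1 V2 : Type*}

/-- A sum over a product which lives on the cross through `(x, y)` splits into the sums
along its two axes. -/
theorem tsum_cross {A : Type*} [AddCommMonoid A] [TopologicalSpace A] [ContinuousAdd A]
    [T2Space A] {F1 : V1 → A} {F2 : V2 → A} (h1 : Summable F1) (h2 : Summable F2)
    (x : V1) (y : V2) :
    ∑' q : V1 × V2, ((if y = q.2 then F1 q.1 else 0) + (if x = q.1 then F2 q.2 else 0)) =
      ∑' x', F1 x' + ∑' y', F2 y' := by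
  have k1 : HasSum (fun q : V1 × V2 => if y = q.2 then F1 q.1 else 0) (∑' x', F1 x') := by
    rw [← (Prod.mk_left_injective y).hasSum_iff]
    · simpa [Function.comp_def] using h1.hasSum
    · rintro ⟨a, b⟩ hab
      exact if_neg fun h => hab ⟨a, by simp [h]⟩
  have k2 : HasSum (fun q : V1 × V2 => if x = q.1 then F2 q.2 else 0) (∑' y', F2 y') := by
    rw [← (Prod.mk_right_injective x).hasSum_iff]
    · simpa [Function.comp_def] using h2.hasSum
    · rintro ⟨a, b⟩ hab
      exact if_neg fun h => hab ⟨b, by simp [h]⟩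
  exact (k1.add k2).tsum_eq

theorem GraphAxioms.finite_support {E : V → V → ℝ} {m : V → ℝ} (h : GraphAxioms E m) (x : V) :
    (Function.support (E x)).Finite :=
  (h.2.2.2.2 x).subset fun y hy => (h.2.1 x y).lt_of_ne (Ne.symm hy)

theorem GraphAxioms.summable {E : V → V → ℝ} {m : V → ℝ} (h : GraphAxioms E m) (x : V) :
    Summable (E x) :=
  summable_of_hasFiniteSupport (h.finite_support x)

theorem GraphAxioms.summable_mul {E : V → V → ℝ} {m : V → ℝ} (h : GraphAxioms E m) (x : V)
    (g : V → ℂ) : Summable fun y => (E x y : ℂ) * g y :=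
  summable_of_hasFiniteSupport <| (h.finite_support x).subset fun y hy h0 => hy <| by simp [h0]

/-- Pointwise formulas for the degree and the magnetic Laplacian of the
product `G = G1 ×_I G2`:
`deg_G(x,y) = deg_{G1}(x)·1_I(y)/m2(y) + deg_{G2}(y)/m1(x)` and
`(Δ_{G,θ} f)(x,y) = (1_I(y)/m2(y))·(Δ_{G1,θ1} f(·,y))(x) + m1(x)⁻¹·(Δ_{G2,θ2} f(x,·))(y)`. -/
theorem product_degree_and_laplacian
    (E1 : V1 → V1 → ℝ) (m1 : V1 → ℝ) (θ1 : V1 → V1 → ℝ)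
    (E2 : V2 → V2 → ℝ) (m2 : V2 → ℝ) (θ2 : V2 → V2 → ℝ) (I : Set V2)
    (hG1 : GraphAxioms E1 m1) (hG2 : GraphAxioms E2 m2)
    (hθ1 : MagneticPotential E1 θ1) (hθ2 : MagneticPotential E2 θ2) :
    (∀ (x : V1) (y : V2),
        degree (prodE E1 E2 I) (prodM m1 m2) (x, y) =
          degree E1 m1 x * (if y ∈ I then (m2 y)⁻¹ else 0) +
            (m1 x)⁻¹ * degree E2 m2 y) ∧
      ∀ f : V1 × V2 → ℂ, (Function.support f).Finite → ∀ (x : V1) (y : V2),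
        lap (prodE E1 E2 I) (prodM m1 m2) (prodTheta θ1 θ2) f (x, y) =
          ((if y ∈ I then (m2 y)⁻¹ else 0 : ℝ) : ℂ) *
              lap E1 m1 θ1 (fun x' => f (x', y)) x +
            ((m1 x : ℝ) : ℂ)⁻¹ * lap E2 m2 θ2 (fun y' => f (x, y')) y := by
  have hE1 := hG1.2.2.1
  have hE2 := hG2.2.2.1
  have hm1 (x : V1) : m1 x ≠ 0 := (hG1.2.2.2.1 x).ne'
  refine ⟨fun x y => ?_, fun f _ x y => ?_⟩
  · have key := tsum_cross ((hG1.summable x).mul_left (if y ∈ I then 1 else 0))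
      (hG2.summable y) x y
    have hsum : ∑' q, prodE E1 E2 I (x, y) q =
        (if y ∈ I then 1 else 0) * ∑' x', E1 x x' + ∑' y', E2 y y' := by
      rw [← tsum_mul_left, ← key]
      refine tsum_congr fun q => ?_
      by_cases hy : y ∈ I <;> simp [prodE, hy]
    have hx := hm1 x
    have hy := (hG2.2.2.2.1 y).ne'
    rw [degree, hsum, degree, degree, prodM]
    split_ifs <;> field_simp <;> ring
  · set g1 : V1 → ℂ := fun x' =>
      f (x, y) - Complex.exp ((θ1 x x' : ℂ) * Complex.I) * f (x', y) with hg1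
    set g2 : V2 → ℂ := fun y' =>
      f (x, y) - Complex.exp ((θ2 y y' : ℂ) * Complex.I) * f (x, y') with hg2
    have key := tsum_cross ((hG1.summable_mul x g1).mul_left (if y ∈ I then 1 else 0))
      (hG2.summable_mul y g2) x y
    have hsum : ∑' q, (prodE E1 E2 I (x, y) q : ℂ) * (f (x, y) -
          Complex.exp ((prodTheta θ1 θ2 (x, y) q : ℂ) * Complex.I) * f q) =
        (if y ∈ I then 1 else 0) * ∑' x', (E1 x x' : ℂ) * g1 x' + ∑' y', (E2 y y' : ℂ) * g2 y' := by
      rw [← tsum_mul_left, ← key]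
      refine tsum_congr fun ⟨a, b⟩ => ?_
      by_cases hb : y = b
      · subst hb
        by_cases ha : x = a
        · subst ha
          simp [prodE, hE1, hE2]
        · by_cases hy : y ∈ I <;> simp [prodE, prodTheta, ha, hy, hg1]
      · by_cases ha : x = a
        · subst ha
          simp [prodE, prodTheta, hb, hg2]
        · simp [prodE, ha, hb]
    have hx : (m1 x : ℂ) ≠ 0 := Complex.ofReal_ne_zero.2 (hm1 x)
    have hy : (m2 y : ℂ) ≠ 0 := Complex.ofReal_ne_zero.2 (hG2.2.2.2.1 y).ne'
    have l1 : lap E1 m1 θ1 (fun x' => f (x', y)) x =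
        (m1 x : ℂ)⁻¹ * ∑' x', (E1 x x' : ℂ) * g1 x' := rfl
    have l2 : lap E2 m2 θ2 (fun y' => f (x, y')) y =
        (m2 y : ℂ)⁻¹ * ∑' y', (E2 y y' : ℂ) * g2 y' := rfl
    rw [lap, hsum, l1, l2, prodM]
    split_ifs <;> push_cast <;> field_simp <;> ring

end MagneticCusp
end
end

section
/- Let G = G1 ×_I G2 be a discrete cusp with I ⊆ V2 nonempty and G connected, and assume that G2 contains a simple cycle (equivalently rad(G2) < ∞). Then the radius of injectivity of G with respect to the weighted length vanishes: rad(G) = 0. -/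
open scoped BigOperators ENNReal

noncomputable section

namespace MagneticCusp

attribute [local instance] Classical.propDecidable

variable {V V1 V2 : Type*}

/-- On a copy `{x} × V2` of the fiber, the product edge weight is that of the fiber. -/
theorem prodE_fiber {E1 : V1 → V1 → ℝ} {m1 : V1 → ℝ} (hG1 : GraphAxioms E1 m1)
    (E2 : V2 → V2 → ℝ) (I : Set V2) (x : V1) (y z : V2) :
    prodE E1 E2 I (x, y) (x, z) = E2 y z := by
  simp [prodE, hG1.2.2.1 x]

/-- A simple cycle of the fiber lifts to a simple cycle of the product over each point. -/
theorem IsSimpleCycle.prod_fiber {E1 : V1 → V1 → ℝ} {m1 : V1 → ℝ} (hG1 : GraphAxioms E1 m1)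
    {E2 : V2 → V2 → ℝ} (I : Set V2) (x : V1) {γ : ℕ → V2} {N : ℕ} (h : IsSimpleCycle E2 γ N) :
    IsSimpleCycle (prodE E1 E2 I) (fun i => (x, γ i)) N := by
  obtain ⟨hN, hclosed, hedge, hinj⟩ := h
  refine ⟨hN, by simp [hclosed], fun i hi => ?_, fun i hi j hj hij => ?_⟩
  · simpa only [prodE_fiber hG1] using hedge i hi
  · exact hinj i hi j hj (congrArg Prod.snd hij)

/-- Lengths of lifted cycles are scaled by the square root of the weight of the base point. -/
theorem cycleLength_prod_fiber {E1 : V1 → V1 → ℝ} {m1 : V1 → ℝ} (hG1 : GraphAxioms E1 m1)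
    (E2 : V2 → V2 → ℝ) (m2 : V2 → ℝ) (I : Set V2) (x : V1) (γ : ℕ → V2) (N : ℕ) :
    cycleLength (prodE E1 E2 I) (prodM m1 m2) (fun i => (x, γ i)) N =
      √(m1 x) * cycleLength E2 m2 γ N := by
  have hx : 0 ≤ m1 x := (hG1.2.2.2.1 x).le
  simp only [cycleLength, edgeLength, prodE_fiber hG1, prodM, Finset.mul_sum]
  refine Finset.sum_congr rfl fun i _ => ?_
  rw [← mul_min_of_nonneg _ _ hx, mul_div_assoc, Real.sqrt_mul hx]

theorem cycleLength_nonneg (E : V → V → ℝ) (m : V → ℝ) (γ : ℕ → V) (N : ℕ) :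
    0 ≤ cycleLength E m γ N :=
  Finset.sum_nonneg fun _ _ => Real.sqrt_nonneg _

theorem H1cond.exists_lt {m1 : V1 → ℝ} (h : H1cond m1) {ε : ℝ} (hε : 0 < ε) :
    ∃ x, m1 x < ε := by
  have := h.1
  obtain ⟨x, hx⟩ := (h.2 ε hε).exists_notMem
  exact ⟨x, not_le.mp hx⟩

/-- A discrete cusp `G = G1 ×_I G2` (with `I` nonempty, `G` connected)
whose fiber `G2` contains a simple cycle has vanishing radius of injectivity. -/
theorem cusp_injRad_zero
    [Fintype V2]
    (E1 : V1 → V1 → ℝ) (m1 : V1 → ℝ) (E2 : V2 → V2 → ℝ) (m2 : V2 → ℝ)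
    (I : Set V2) (hI : I.Nonempty)
    (hG1 : GraphAxioms E1 m1) (hG2 : GraphAxioms E2 m2)
    (hH1 : H1cond m1) (hH3 : H3cond E1 m1)
    (hconn : Conn (prodE E1 E2 I))
    (hcyc : ∃ (γ : ℕ → V2) (N : ℕ), IsSimpleCycle E2 γ N) :
    injRad (prodE E1 E2 I) (prodM m1 m2) = 0 := by
  obtain ⟨γ, N, hγ⟩ := hcyc
  suffices h : girth (prodE E1 E2 I) (prodM m1 m2) = 0 by simp [injRad, h]
  refine le_antisymm (ENNReal.le_of_forall_pos_le_add fun δ hδ _ => ?_) zero_le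
  set C := cycleLength E2 m2 γ N
  have hC : 0 ≤ C := cycleLength_nonneg E2 m2 γ N
  have hε : 0 < (δ : ℝ) / (C + 1) := by positivity
  obtain ⟨x, hx⟩ := hH1.exists_lt (pow_pos hε 2)
  rw [zero_add, ← ENNReal.ofReal_coe_nnreal]
  refine (iInf_le _ ⟨(fun i => (x, γ i), N), hγ.prod_fiber hG1 I x⟩).trans
    (ENNReal.ofReal_le_ofReal ?_)
  rw [cycleLength_prod_fiber hG1]
  calc √(m1 x) * C ≤ (δ : ℝ) / (C + 1) * (C + 1) := by
        gcongr
        · exact Real.sqrt_le_iff.mpr ⟨hε.le, hx.le⟩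
        · linarith
    _ = δ := by field_simp

end MagneticCusp
end
end

section
/- Let G1 = (E1, V1, m1) and G2 = (E2, V2, m2) be weighted graphs satisfying (H1) V1 is infinite and for every ε > 0 the set {x ∈ V1 : m1(x) ≥ ε} is finite, (H2) G2 is finite, and (H3) sup_{x∈V1} deg_{G1}(x) < ∞. Then the Cartesian product G1 × G2 has strictly positive radius of injectivity with respect to the weighted length: rad(G1 × G2) > 0. -/
open scoped BigOperators ENNReal

noncomputable section

namespace MagneticCusp

attribute [local instance] Classical.propDecidable

variable {V V1 V2 : Type*}

/-- An edge weight is at most the degree times the vertex weight. -/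
theorem edge_le_degree_mul {E : V → V → ℝ} {m : V → ℝ} (hG : GraphAxioms E m) (x y : V) :
    E x y ≤ degree E m x * m x := by
  obtain ⟨-, hnn, -, hm, hfin⟩ := hG
  have hs : Summable (E x) := by
    refine summable_of_hasFiniteSupport ((hfin x).subset fun z hz => ?_)
    exact lt_of_le_of_ne (hnn x z) (Ne.symm hz)
  have hle := hs.le_tsum y fun z _ => hnn x z
  have hmx := (hm x).ne'
  unfold degree
  rwa [mul_comm, mul_inv_cancel_left₀ hmx]

theorem cartE_symm {E1 : V1 → V1 → ℝ} {m1 : V1 → ℝ} {E2 : V2 → V2 → ℝ} {m2 : V2 → ℝ}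
    (h1 : ∀ x y, E1 x y = E1 y x) (h2 : ∀ x y, E2 x y = E2 y x) (p q : V1 × V2) :
    cartE E1 m1 E2 m2 p q = cartE E1 m1 E2 m2 q p := by
  obtain ⟨x, y⟩ := p
  obtain ⟨x', y'⟩ := q
  by_cases hx : x = x' <;> by_cases hy : y = y' <;>
    simp [cartE, hx, hy, Ne.symm, h1 x x', h2 y y']

/-- Degree bounds on the factors bound the edge weights of the Cartesian product. -/
theorem cartE_le_mul_prodM {E1 : V1 → V1 → ℝ} {m1 : V1 → ℝ} {E2 : V2 → V2 → ℝ} {m2 : V2 → ℝ}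
    (hG1 : GraphAxioms E1 m1) (hG2 : GraphAxioms E2 m2) {d1 d2 : ℝ} (hd1 : 0 ≤ d1) (hd2 : 0 ≤ d2)
    (h1 : ∀ x, degree E1 m1 x ≤ d1) (h2 : ∀ y, degree E2 m2 y ≤ d2) (p q : V1 × V2) :
    cartE E1 m1 E2 m2 p q ≤ (d1 + d2) * prodM m1 m2 p := by
  have hm1 := hG1.2.2.2.1 p.1
  have hm2 := hG2.2.2.2.1 p.2
  have hE1 : E1 p.1 q.1 ≤ d1 * m1 p.1 :=
    (edge_le_degree_mul hG1 _ _).trans (mul_le_mul_of_nonneg_right (h1 _) hm1.le)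
  have hE2 : E2 p.2 q.2 ≤ d2 * m2 p.2 :=
    (edge_le_degree_mul hG2 _ _).trans (mul_le_mul_of_nonneg_right (h2 _) hm2.le)
  have hA : (if p.2 = q.2 then E1 p.1 q.1 * m2 p.2 else 0) ≤ d1 * m1 p.1 * m2 p.2 := by
    split_ifs
    · exact mul_le_mul_of_nonneg_right hE1 hm2.le
    · positivity
  have hB : (if p.1 = q.1 then m1 p.1 * E2 p.2 q.2 else 0) ≤ m1 p.1 * (d2 * m2 p.2) := by
    split_ifs
    · exact mul_le_mul_of_nonneg_left hE2 hm1.le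
    · positivity
  unfold cartE prodM
  linarith

/-- The radius of injectivity is positive when every edge weight is bounded by a constant
multiple of the weights of its endpoints. -/
theorem injRad_pos_of_edge_le {E : V → V → ℝ} {m : V → ℝ} {D : ℝ} (hD : 0 < D)
    (hsymm : ∀ x y, E x y = E y x) (hle : ∀ x y, E x y ≤ D * m x) : 0 < injRad E m := by
  have hlen : ∀ x y, 0 < E x y → Real.sqrt D⁻¹ ≤ edgeLength E m x y := by
    intro x y hxy
    refine Real.sqrt_le_sqrt ?_
    rw [le_div_iff₀ hxy, inv_mul_le_iff₀ hD, mul_min_of_nonneg _ _ hD.le]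
    exact le_min (hle x y) (hsymm x y ▸ hle y x)
  have hgirth : ENNReal.ofReal (Real.sqrt D⁻¹) ≤ girth E m := by
    refine le_iInf fun c => ENNReal.ofReal_le_ofReal ?_
    obtain ⟨⟨γ, N⟩, hN, -, hedge, -⟩ := c
    have h0 : 0 < N := by omega
    refine (hlen _ _ (hedge 0 h0)).trans ?_
    exact Finset.single_le_sum (f := fun i => edgeLength E m (γ i) (γ (i + 1)))
      (fun i _ => Real.sqrt_nonneg _) (Finset.mem_range.2 h0)
  have hpos : 0 < ENNReal.ofReal (Real.sqrt D⁻¹) :=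
    ENNReal.ofReal_pos.2 (Real.sqrt_pos.2 (inv_pos.2 hD))
  exact ENNReal.div_pos (hpos.trans_le hgirth).ne' ENNReal.ofNat_ne_top

/-- Under (H1), (H2), (H3), the *Cartesian* product `G1 × G2` has
strictly positive radius of injectivity. -/
theorem cartesian_injRad_positive
    [Fintype V2]
    (E1 : V1 → V1 → ℝ) (m1 : V1 → ℝ) (E2 : V2 → V2 → ℝ) (m2 : V2 → ℝ)
    (hG1 : GraphAxioms E1 m1) (hG2 : GraphAxioms E2 m2)
    (hconn1 : Conn E1) (hconn2 : Conn E2)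
    (hH1 : H1cond m1) (hH3 : H3cond E1 m1) :
    0 < injRad (cartE E1 m1 E2 m2) (prodM m1 m2) := by
  obtain ⟨d1, hd1⟩ := hH3
  obtain ⟨d2, hd2⟩ := (Set.finite_range (degree E2 m2)).bddAbove
  have hle := cartE_le_mul_prodM hG1 hG2 (abs_nonneg d1)
    (d2 := |d2| + 1) (by positivity) (fun x => (hd1 x).trans (le_abs_self d1))
    (fun y => by linarith [hd2 (Set.mem_range_self y), le_abs_self d2])
  exact injRad_pos_of_edge_le (by positivity) (cartE_symm hG1.1 hG2.1) hle

end MagneticCusp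
end
end

section
/- Let G = G1 ×_I G2 be connected with I ⊆ V2 nonempty, where G2 is finite (H2), V1 is infinite with {x ∈ V1 : m1(x) ≥ ε} finite for every ε > 0 (H1), and the magnetic potential θ2 on G2 satisfies Hol_{θ2} ≠ 0. Then the magnetic Laplacian Δ_{G,θ} has compact resolvent, and for every λ ≥ 0 one has N_λ(m1^{-1}(·) ⊗ Δ_{G2,θ2}) ≥ N_λ(Δ_{G,θ}). -/
open scoped BigOperators ENNReal

noncomputable section

namespace MagneticCusp

attribute [local instance] Classical.propDecidable

variable {V V1 V2 : Type*}

theorem Conn.mono {E : V → V → ℝ} {p : V → Prop} (h : Conn E)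
    (hstep : ∀ x y, 0 < E x y → p x → p y) {x : V} (hx : p x) (y : V) : p y := by
  induction h x y with
  | refl => exact hx
  | tail _ hbc ih => exact hstep _ _ hbc ih

/-- A nonzero function that is parallel along every edge forces trivial holonomy. -/
theorem holTrivial_of_parallel {E θ : V → V → ℝ} (hconn : Conn E) {u : V → ℂ}
    (hpar : ∀ x y, 0 < E x y → u x = Complex.exp ((θ x y : ℂ) * Complex.I) * u y)
    (hu : u ≠ 0) : HolTrivial E θ := by
  obtain ⟨x₀, hx₀⟩ := Function.ne_iff.mp hu
  have hne : ∀ x, u x ≠ 0 := hconn.mono (p := fun x => u x ≠ 0) (fun x y hxy hx hy => hx (by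
    rw [hpar x y hxy, hy, mul_zero])) hx₀
  intro γ N hγ
  have key : ∀ n ≤ N, u (γ 0) = Complex.exp ((hol θ γ n : ℂ) * Complex.I) * u (γ n) := by
    intro n
    induction n with
    | zero => simp [hol]
    | succ n ih =>
      intro hn
      rw [ih (by omega), hpar _ _ (hγ.2 n (by omega)), ← mul_assoc, ← Complex.exp_add]
      simp only [hol, Finset.sum_range_succ]
      push_cast
      ring_nf
  have h := key N le_rfl
  rw [hγ.1] at h
  have h1 : Complex.exp ((hol θ γ N : ℂ) * Complex.I) = 1 :=
    mul_right_cancel₀ (hne (γ 0)) (by rw [one_mul, ← h])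
  obtain ⟨k, hk⟩ := Complex.exp_eq_one_iff.mp h1
  refine ⟨k, ?_⟩
  have h2 : (hol θ γ N : ℂ) * Complex.I = ((2 * Real.pi * k : ℝ) : ℂ) * Complex.I := by
    rw [hk]
    push_cast
    ring
  exact Complex.ofReal_injective (mul_right_cancel₀ Complex.I_ne_zero h2)

theorem quadForm_nonneg {E θ : V → V → ℝ} (hE : ∀ x y, 0 ≤ E x y) (f : V → ℂ) :
    0 ≤ quadForm E θ f :=
  mul_nonneg (by norm_num) <| tsum_nonneg fun _ => tsum_nonneg fun _ =>
    mul_nonneg (hE _ _) (sq_nonneg _)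

theorem quadForm_zero (E θ : V → V → ℝ) : quadForm E θ 0 = 0 := by
  simp [quadForm]

theorem quadForm_smul (E θ : V → V → ℝ) (a : ℂ) (f : V → ℂ) :
    quadForm E θ (a • f) = ‖a‖ ^ 2 * quadForm E θ f := by
  have h : ∀ x y, E x y *
      ‖(a • f) x - Complex.exp ((θ x y : ℂ) * Complex.I) * (a • f) y‖ ^ 2 =
      ‖a‖ ^ 2 * (E x y * ‖f x - Complex.exp ((θ x y : ℂ) * Complex.I) * f y‖ ^ 2) := by
    intro x y
    have : (a • f) x - Complex.exp ((θ x y : ℂ) * Complex.I) * (a • f) y =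
        a * (f x - Complex.exp ((θ x y : ℂ) * Complex.I) * f y) := by
      simp only [Pi.smul_apply, smul_eq_mul]
      ring
    rw [this, norm_mul]
    ring
  simp only [quadForm, h, tsum_mul_left]
  ring

theorem continuous_quadForm [Fintype V] (E θ : V → V → ℝ) : Continuous (quadForm E θ) := by
  unfold quadForm
  simp only [tsum_fintype]
  fun_prop

theorem quadForm_pos [Finite V] {E θ : V → V → ℝ} (hE : ∀ x y, 0 ≤ E x y) (hconn : Conn E)
    (hhol : ¬HolTrivial E θ) {u : V → ℂ} (hu : u ≠ 0) : 0 < quadForm E θ u := by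
  cases nonempty_fintype V
  refine (quadForm_nonneg hE u).lt_of_ne fun h0 => hhol ?_
  refine holTrivial_of_parallel hconn (fun x y hxy => ?_) hu
  simp only [quadForm, tsum_fintype] at h0
  have hnn : ∀ x y, 0 ≤ E x y * ‖u x - Complex.exp ((θ x y : ℂ) * Complex.I) * u y‖ ^ 2 :=
    fun x y => mul_nonneg (hE x y) (sq_nonneg _)
  have h1 := (Finset.sum_eq_zero_iff_of_nonneg fun x _ =>
    Finset.sum_nonneg fun y _ => hnn x y).mp (by linarith) x (Finset.mem_univ x)
  have h2 := (Finset.sum_eq_zero_iff_of_nonneg fun y _ => hnn x y).mp h1 y (Finset.mem_univ y)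
  simpa [hxy.ne', sub_eq_zero] using h2

/-- With nontrivial holonomy, the magnetic form of a finite connected graph is coercive. -/
theorem exists_pos_mul_sum_le_quadForm [Fintype V] {E θ : V → V → ℝ} {m : V → ℝ}
    (hE : ∀ x y, 0 ≤ E x y) (hm : ∀ x, 0 ≤ m x) (hconn : Conn E) (hhol : ¬HolTrivial E θ) :
    ∃ c : ℝ, 0 < c ∧ ∀ u : V → ℂ, c * ∑ x, m x * ‖u x‖ ^ 2 ≤ quadForm E θ u := by
  obtain ⟨a, ha, haQ⟩ : ∃ a : ℝ, 0 < a ∧ ∀ u ∈ Metric.sphere (0 : V → ℂ) 1,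
      a ≤ quadForm E θ u := by
    rcases (Metric.sphere (0 : V → ℂ) 1).eq_empty_or_nonempty with h | h
    · exact ⟨1, one_pos, by simp [h]⟩
    · obtain ⟨v, hv, hmin⟩ := (isCompact_sphere (0 : V → ℂ) 1).exists_isMinOn h
        (continuous_quadForm E θ).continuousOn
      refine ⟨_, quadForm_pos hE hconn hhol ?_, fun u hu => hmin hu⟩
      rintro rfl
      simp at hv
  have hM : 0 ≤ ∑ x, m x := Finset.sum_nonneg fun x _ => hm x
  refine ⟨a / (∑ x, m x + 1), by positivity, fun u => ?_⟩
  have h1 : a * ‖u‖ ^ 2 ≤ quadForm E θ u := by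
    by_cases hu : u = 0
    · simp [hu, quadForm_zero]
    have hn : 0 < ‖u‖ := norm_pos_iff.mpr hu
    have h := haQ (((‖u‖⁻¹ : ℝ) : ℂ) • u) (by
      simp [norm_smul, hn.ne'])
    rw [quadForm_smul, Complex.norm_real, Real.norm_of_nonneg (by positivity), inv_pow,
      inv_mul_eq_div, le_div_iff₀ (by positivity)] at h
    exact h
  have h2 : ∑ x, m x * ‖u x‖ ^ 2 ≤ (∑ x, m x + 1) * ‖u‖ ^ 2 := by
    calc ∑ x, m x * ‖u x‖ ^ 2 ≤ ∑ x, m x * ‖u‖ ^ 2 := by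
          gcongr with x
          · exact hm x
          · exact norm_le_pi_norm u x
      _ = (∑ x, m x) * ‖u‖ ^ 2 := by rw [Finset.sum_mul]
      _ ≤ _ := by gcongr; linarith
  refine le_trans ?_ h1
  rw [div_mul_eq_mul_div, div_le_iff₀ (by positivity)]
  nlinarith

theorem summable_of_support_subset {f : V → ℂ} (hf : (Function.support f).Finite) {g : V → ℝ}
    (h : ∀ x, f x = 0 → g x = 0) : Summable g :=
  summable_of_hasFiniteSupport (hf.subset fun x hx hfx => hx (h x hfx))

/-- The form sums converge for finitely supported functions on a locally finite graph. -/
theorem summable_quadForm {E θ : V → V → ℝ} (hsymm : ∀ x y, E x y = E y x)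
    (hfin : ∀ x, {y | E x y ≠ 0}.Finite) {f : V → ℂ} (hf : (Function.support f).Finite) :
    Summable fun x => ∑' y, E x y * ‖f x - Complex.exp ((θ x y : ℂ) * Complex.I) * f y‖ ^ 2 := by
  refine summable_of_hasFiniteSupport
    ((hf.union (hf.biUnion fun y _ => hfin y)).subset fun x hx => ?_)
  by_contra hx'
  simp only [Set.mem_union, Set.mem_iUnion, not_or, not_exists, Function.mem_support,
    not_not, Set.mem_ofPred_eq] at hx'
  refine hx ((tsum_congr fun y => ?_).trans tsum_zero)
  by_cases hy : f y = 0
  · simp [hx'.1, hy]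
  · rw [hsymm, hx'.2 y hy, zero_mul]

theorem finite_prodE_ne_zero [Finite V2] {E1 : V1 → V1 → ℝ} {m1 : V1 → ℝ}
    (hG1 : GraphAxioms E1 m1) (E2 : V2 → V2 → ℝ) (I : Set V2) (p : V1 × V2) :
    {q | prodE E1 E2 I p q ≠ 0}.Finite := by
  refine (((hG1.2.2.2.2 p.1).insert p.1).prod (Set.finite_univ (α := V2))).subset fun q hq => ?_
  refine ⟨?_, Set.mem_univ _⟩
  by_contra h
  simp only [Set.mem_insert_iff, not_or, Set.mem_ofPred_eq, not_lt] at h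
  refine hq ?_
  have h0 : E1 p.1 q.1 = 0 := le_antisymm h.2 (hG1.2.1 _ _)
  simp [prodE, h0, Ne.symm h.1]

/-- Dropping the edges in the `G1` direction decreases the form. -/
theorem fiberForm_le_quadForm [Fintype V2] {E1 : V1 → V1 → ℝ} {m1 : V1 → ℝ}
    {θ1 : V1 → V1 → ℝ} {E2 : V2 → V2 → ℝ} {m2 : V2 → ℝ} (θ2 : V2 → V2 → ℝ) (I : Set V2)
    (hG1 : GraphAxioms E1 m1) (hG2 : GraphAxioms E2 m2) (hθ1 : MagneticPotential E1 θ1)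
    {f : V1 × V2 → ℂ} (hf : (Function.support f).Finite) :
    fiberForm E2 θ2 f ≤ quadForm (prodE E1 E2 I) (prodTheta θ1 θ2) f := by
  have hsymm : ∀ p q, prodE E1 E2 I p q = prodE E1 E2 I q p := by
    intro p q
    simp only [prodE]
    congr 1
    · refine if_ctx_congr ⟨fun h => ⟨h.1.symm, h.1 ▸ h.2⟩, fun h => ⟨h.1.symm, h.1 ▸ h.2⟩⟩
        (fun _ => hG1.1 _ _) (fun _ => rfl)
    · exact if_ctx_congr eq_comm (fun _ => hG2.1 _ _) (fun _ => rfl)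
  have hnn : ∀ p q, 0 ≤ prodE E1 E2 I p q := by
    intro p q
    unfold prodE
    have := hG1.2.1 p.1 q.1
    have := hG2.2.1 p.2 q.2
    split_ifs <;> positivity
  have hfin := finite_prodE_ne_zero hG1 E2 I
  have hS := summable_quadForm (θ := prodTheta θ1 θ2) hsymm hfin hf
  set T : V1 × V2 → V1 × V2 → ℝ := fun p q => prodE E1 E2 I p q *
    ‖f p - Complex.exp ((prodTheta θ1 θ2 p q : ℂ) * Complex.I) * f q‖ ^ 2 with hT
  have hTnn : ∀ p q, 0 ≤ T p q := fun p q => mul_nonneg (hnn p q) (sq_nonneg _)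
  have hθ0 : ∀ x, θ1 x x = 0 := fun x => by linarith [hθ1.1 x x]
  set B : V1 × V2 → ℝ := fun p => ∑ y, E2 p.2 y *
    ‖f p - Complex.exp ((θ2 p.2 y : ℂ) * Complex.I) * f (p.1, y)‖ ^ 2 with hB
  have hTB : ∀ p, ∑' y, T p (p.1, y) = B p := by
    intro p
    rw [tsum_fintype]
    refine Finset.sum_congr rfl fun y _ => ?_
    simp [hT, prodE, prodTheta, hG1.2.2.1, hθ0]
  have hBle : ∀ p, B p ≤ ∑' q, T p q := by
    intro p
    rw [← hTB]
    refine tsum_comp_le_tsum_of_inj (f := T p) ?_ (hTnn p) (i := fun y => (p.1, y))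
      (Prod.mk_right_injective p.1)
    refine summable_of_hasFiniteSupport ((hfin p).subset fun q hq h0 => hq ?_)
    simp [hT, h0]
  have hBnn : ∀ p, 0 ≤ B p := fun p => by
    rw [← hTB]
    exact tsum_nonneg fun y => hTnn _ _
  have hBs : Summable B := Summable.of_nonneg_of_le hBnn hBle hS
  calc fiberForm E2 θ2 f = (1 / 2) * ∑' x, ∑' y, B (x, y) := by
        simp only [fiberForm, quadForm, tsum_mul_left, hB, tsum_fintype]
    _ = (1 / 2) * ∑' p, B p := by rw [hBs.tsum_prod]
    _ ≤ (1 / 2) * ∑' p, ∑' q, T p q := by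
        exact mul_le_mul_of_nonneg_left (hBs.tsum_le_tsum hBle hS) (by norm_num)
    _ = _ := rfl

theorem finite_support_of_mem_span {ι : Type*} {g : ι → V → ℂ}
    (hg : ∀ i, (Function.support (g i)).Finite) {f : V → ℂ}
    (hf : f ∈ Submodule.span ℂ (Set.range g)) : (Function.support f).Finite := by
  induction hf using Submodule.span_induction with
  | mem x hx => obtain ⟨i, rfl⟩ := hx; exact hg i
  | zero => simp
  | add x y _ _ hx hy => exact (hx.union hy).subset (Function.support_add x y)
  | smul a x _ hx => exact hx.subset (Function.support_const_smul_subset a x)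

theorem DimGE.mono {Q Q' : (V → ℂ) → ℝ} {m : V → ℝ} {lam : ℝ} {k : ℕ}
    (hQ : ∀ f : V → ℂ, (Function.support f).Finite → Q' f ≤ Q f) (h : DimGE Q m lam k) :
    DimGE Q' m lam k := by
  obtain ⟨g, hli, hfin, hle⟩ := h
  exact ⟨g, hli, hfin, fun f hf =>
    (hQ f (finite_support_of_mem_span hfin hf)).trans (hle f hf)⟩

/-- If low-energy functions are determined by their values on a finite set, then there is a
uniform bound on the dimension of low-energy spaces. -/
theorem DimGE.le_ncard {Q : (V → ℂ) → ℝ} {m : V → ℝ} {lam : ℝ} {k : ℕ} {F : Set V}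
    (hF : F.Finite) (hQ : ∀ f : V → ℂ, (Function.support f).Finite → Q f ≤ lam * nrmSq m f →
      (∀ x ∈ F, f x = 0) → f = 0) (h : DimGE Q m lam k) : k ≤ F.ncard := by
  obtain ⟨g, hli, hfin, hle⟩ := h
  have := hF.fintype
  have hli' := hli.map (f := LinearMap.funLeft ℂ ℂ (Subtype.val : F → V)) (by
    rw [Submodule.disjoint_def]
    intro f hf hker
    exact hQ f (finite_support_of_mem_span hfin hf) (hle f hf) fun x hx =>
      congrFun (LinearMap.mem_ker.mp hker) ⟨x, hx⟩)
  have := hli'.fintype_card_le_finrank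
  rwa [Fintype.card_fin, Module.finrank_fintype_fun_eq_card, ← Nat.card_eq_fintype_card] at this

theorem compactResolvent_fiberForm [Fintype V2] {m1 : V1 → ℝ} {E2 θ2 : V2 → V2 → ℝ}
    {m2 : V2 → ℝ} (hm1 : ∀ x, 0 < m1 x) (hG2 : GraphAxioms E2 m2) (hconn2 : Conn E2)
    (hH1 : ∀ ε : ℝ, 0 < ε → {x : V1 | ε ≤ m1 x}.Finite) (hhol : ¬HolTrivial E2 θ2) :
    CompactResolvent (fiberForm (V1 := V1) E2 θ2) (prodM m1 m2) := by
  have hm2 := hG2.2.2.2.1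
  obtain ⟨c, hc, hcQ⟩ := exists_pos_mul_sum_le_quadForm hG2.2.1 (fun x => (hm2 x).le) hconn2 hhol
  intro lam
  set L : ℝ := max lam 1
  have hL : 0 < L := lt_max_of_lt_right one_pos
  refine ⟨_, fun k hk => hk.le_ncard ((hH1 (c / L) (by positivity)).prod
    (Set.finite_univ (α := V2))) fun f hf hle hzero => ?_⟩
  by_contra hne
  obtain ⟨p₀, hp₀⟩ := Function.ne_iff.mp hne
  have hsN : Summable fun p : V1 × V2 => prodM m1 m2 p * ‖f p‖ ^ 2 :=
    summable_of_support_subset hf fun p hp => by simp [hp]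
  have hsM : Summable fun p : V1 × V2 => m2 p.2 * ‖f p‖ ^ 2 :=
    summable_of_support_subset hf fun p hp => by simp [hp]
  have hlow : c * ∑' p : V1 × V2, m2 p.2 * ‖f p‖ ^ 2 ≤ fiberForm E2 θ2 f := by
    rw [hsM.tsum_prod, ← tsum_mul_left]
    simp only [tsum_fintype]
    refine Summable.tsum_le_tsum (fun x => hcQ _) ?_ ?_
    · have := hsM.prod.mul_left c
      simpa only [tsum_fintype] using this
    · refine summable_of_hasFiniteSupport ((hf.image Prod.fst).subset fun x hx => ?_)
      by_contra h
      refine hx ?_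
      have h0 : (fun y => f (x, y)) = 0 := funext fun y => by
        by_contra hy
        exact h ⟨(x, y), hy, rfl⟩
      simp only [h0, quadForm_zero]
  have hup : fiberForm E2 θ2 f ≤ L * nrmSq (prodM m1 m2) f :=
    hle.trans (mul_le_mul_of_nonneg_right (le_max_left _ _)
      (tsum_nonneg fun p => mul_nonneg (mul_pos (hm1 _) (hm2 _)).le (sq_nonneg _)))
  have hlt : ∀ p, f p ≠ 0 →
      L * (prodM m1 m2 p * ‖f p‖ ^ 2) < c * (m2 p.2 * ‖f p‖ ^ 2) := by
    intro p hp
    have h1 : m1 p.1 < c / L := by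
      by_contra h
      exact hp (hzero p ⟨not_lt.mp h, Set.mem_univ _⟩)
    rw [lt_div_iff₀ hL] at h1
    have h2 : 0 < m2 p.2 * ‖f p‖ ^ 2 := mul_pos (hm2 _) (by positivity)
    unfold prodM
    nlinarith
  have hstrict : L * nrmSq (prodM m1 m2) f < c * ∑' p : V1 × V2, m2 p.2 * ‖f p‖ ^ 2 := by
    rw [nrmSq, ← tsum_mul_left, ← tsum_mul_left]
    refine Summable.tsum_lt_tsum (fun p => ?_) (hlt p₀ hp₀) (hsN.mul_left L) (hsM.mul_left c)
    by_cases hp : f p = 0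
    · simp [hp]
    · exact (hlt p hp).le
  linarith

/-- If `G = G1 ×_I G2` is connected with `I` nonempty, `G2` finite,
(H1) holds and `Hol_{θ2} ≠ 0`, then `Δ_{G,θ}` has compact resolvent and for all
`λ ≥ 0`, `N_λ(m1⁻¹(·) ⊗ Δ_{G2,θ2}) ≥ N_λ(Δ_{G,θ})` (encoded via the min-max
principle over the form core). -/
theorem compact_resolvent_of_nontrivial_holonomy
    [Fintype V2]
    (E1 : V1 → V1 → ℝ) (m1 : V1 → ℝ) (θ1 : V1 → V1 → ℝ)
    (E2 : V2 → V2 → ℝ) (m2 : V2 → ℝ) (θ2 : V2 → V2 → ℝ)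
    (I : Set V2) (hI : I.Nonempty)
    (hG1 : GraphAxioms E1 m1) (hG2 : GraphAxioms E2 m2)
    (hθ1 : MagneticPotential E1 θ1) (hθ2 : MagneticPotential E2 θ2)
    (hconn1 : Conn E1) (hconn2 : Conn E2) (hconn : Conn (prodE E1 E2 I))
    (hH1 : H1cond m1)
    (hhol : ¬HolTrivial E2 θ2) :
    CompactResolvent (quadForm (prodE E1 E2 I) (prodTheta θ1 θ2)) (prodM m1 m2) ∧
      ∀ lam : ℝ, 0 ≤ lam →
        (∀ k : ℕ,
          DimGE (quadForm (prodE E1 E2 I) (prodTheta θ1 θ2)) (prodM m1 m2) lam k →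
            DimGE (fiberForm (V1 := V1) E2 θ2) (prodM m1 m2) lam k) ∧
        countEig (quadForm (prodE E1 E2 I) (prodTheta θ1 θ2)) (prodM m1 m2) lam ≤
          countEig (fiberForm (V1 := V1) E2 θ2) (prodM m1 m2) lam := by
  have hle : ∀ f : V1 × V2 → ℂ, (Function.support f).Finite → fiberForm E2 θ2 f ≤
      quadForm (prodE E1 E2 I) (prodTheta θ1 θ2) f :=
    fun f hf => fiberForm_le_quadForm θ2 I hG1 hG2 hθ1 hf
  have hcomp := compactResolvent_fiberForm hG1.2.2.2.1 hG2 hconn2 hH1.2 hhol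
  refine ⟨fun lam => ?_, fun lam _ => ⟨fun k hk => hk.mono hle, ?_⟩⟩
  · obtain ⟨n, hn⟩ := hcomp lam
    exact ⟨n, fun k hk => hn k (hk.mono hle)⟩
  · obtain ⟨n, hn⟩ := hcomp lam
    exact csSup_le_csSup' ⟨n, fun k hk => hn k hk⟩ fun k hk => hk.mono hle

end MagneticCusp
end
end
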